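/- Let λ > 1 and μ > 0. There exists ν₀ > μϱ(λ) such that for every ν ≥ ν₀, every maximizer ω ∈ Σ_{μ,ν,λ} satisfies the strict mass inequality ∫_Π ω dx < ν. -/

import Mathlib

open MeasureTheory Real Filter

noncomputable section

/-- The upper half plane `Π = {x ∈ ℝ² : x₂ > 0}`. -/
def UHP : Set (ℝ × ℝ) := {x | 0 < x.2}

/-- Euclidean norm of a point of `ℝ²`. -/
def rad (x : ℝ × ℝ) : ℝ := Real.sqrt (x.1 ^ 2 + x.2 ^ 2)

/-- Modified Bessel function of the second kind of order `0`:
`K₀(r) = ∫₀^∞ exp(-r cosh t) dt`. -/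
def K0 (r : ℝ) : ℝ := ∫ t in Set.Ioi (0 : ℝ), Real.exp (-(r * Real.cosh t))

/-- Fundamental solution `G(x,y) = (1/2π) K₀(|x-y|)` of `−Δ + Id` on `ℝ²`. -/
def Gker (x y : ℝ × ℝ) : ℝ := (1 / (2 * Real.pi)) * K0 (rad (x - y))

/-- Reflection `x̄ = (x₁, −x₂)` across the `x₁`-axis. -/
def reflPt (x : ℝ × ℝ) : ℝ × ℝ := (x.1, -x.2)

/-- Green's function `G_Π(x,y) = G(x,y) − G(x̄,y)` of `−Δ + Id` on the half plane. -/
def GUHP (x y : ℝ × ℝ) : ℝ := Gker x y - Gker (reflPt x) y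

/-- The operator `𝒢ω(x) = ∫_Π G_Π(x,y) ω(y) dy`. -/
def Gop (ω : ℝ × ℝ → ℝ) (x : ℝ × ℝ) : ℝ := ∫ y in UHP, GUHP x y * ω y

/-- Kinetic energy `E(ω) = (1/2) ∫_Π ω 𝒢ω`. -/
def kineticE (ω : ℝ × ℝ → ℝ) : ℝ := (1 / 2) * ∫ x in UHP, ω x * Gop ω x

/-- Impulse `I(ω) = ∫_Π x₂ ω dx`. -/
def impulse (ω : ℝ × ℝ → ℝ) : ℝ := ∫ x in UHP, x.2 * ω x

/-- `L¹(Π)` norm. -/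
def normL1 (f : ℝ × ℝ → ℝ) : ℝ := ∫ x in UHP, |f x|

/-- `L²(Π)` norm. -/
def normL2 (f : ℝ × ℝ → ℝ) : ℝ := (∫ x in UHP, (f x) ^ 2) ^ ((1 : ℝ) / 2)

/-- `L^s(Π)` norm. -/
def normLs (s : ℝ) (f : ℝ × ℝ → ℝ) : ℝ := (∫ x in UHP, |f x| ^ s) ^ (1 / s)

/-- Nonnegative member of `L¹(Π) ∩ L²(Π)`. -/
def NonnegL1L2 (ω : ℝ × ℝ → ℝ) : Prop :=
  (∀ x ∈ UHP, 0 ≤ ω x) ∧ IntegrableOn ω UHP ∧ IntegrableOn (fun x => (ω x) ^ 2) UHP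

/-- Steiner symmetry in the `x₁` variable. -/
def SteinerSym (f : ℝ × ℝ → ℝ) : Prop :=
  (∀ x : ℝ × ℝ, f (-x.1, x.2) = f x) ∧
  ∀ x₂ : ℝ, 0 < x₂ → AntitoneOn (fun x₁ => f (x₁, x₂)) (Set.Ioi (0 : ℝ))

/-- The admissible class `𝒜_{μ,ν}`. -/
def InAdm (μ ν : ℝ) (ω : ℝ × ℝ → ℝ) : Prop :=
  (∀ x ∈ UHP, 0 ≤ ω x) ∧ IntegrableOn ω UHP ∧ IntegrableOn (fun x => (ω x) ^ 2) UHP ∧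
  IntegrableOn (fun x => x.2 * ω x) UHP ∧
  impulse ω = μ ∧ (∫ x in UHP, ω x) ≤ ν

/-- The energy functional `ℰ_λ(ω) = E(ω) − (1/(2λ)) ∫_Π ω²`. -/
def Efun (lam : ℝ) (ω : ℝ × ℝ → ℝ) : ℝ :=
  kineticE ω - (1 / (2 * lam)) * ∫ x in UHP, (ω x) ^ 2

/-- The supremum `S_{μ,ν,λ} = sup_{ω ∈ 𝒜_{μ,ν}} ℰ_λ(ω)`. -/
def Sval (lam μ ν : ℝ) : ℝ := sSup {s | ∃ ω, InAdm μ ν ω ∧ s = Efun lam ω}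

/-- `ω` is a maximizer, i.e. `ω ∈ Σ_{μ,ν,λ}`. -/
def IsMaximizer (lam μ ν : ℝ) (ω : ℝ × ℝ → ℝ) : Prop :=
  InAdm μ ν ω ∧ Efun lam ω = Sval lam μ ν

/-- Bessel function of the first kind of order one. -/
def J1 (r : ℝ) : ℝ :=
  ∑' k : ℕ, ((-1 : ℝ) ^ k / ((Nat.factorial k : ℝ) * (Nat.factorial (k + 1) : ℝ))) *
    (r / 2) ^ (2 * k + 1)

/-- Modified Bessel function of the second kind of order one. -/
def K1 (r : ℝ) : ℝ := ∫ t in Set.Ioi (0 : ℝ), Real.exp (-(r * Real.cosh t)) * Real.cosh t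

/-- The set of `t > 0` with `J₁(√(λ−1) t) ≠ 0` solving the transcendental equation
`t (K₁'(t)/K₁(t) + (λ−1)^{-1/2} J₁'(√(λ−1)t)/J₁(√(λ−1)t)) = λ/(λ−1)`. -/
def aSet (lam : ℝ) : Set ℝ :=
  {t | 0 < t ∧ J1 (Real.sqrt (lam - 1) * t) ≠ 0 ∧
    t * (deriv K1 t / K1 t +
      (1 / Real.sqrt (lam - 1)) *
        (deriv J1 (Real.sqrt (lam - 1) * t) / J1 (Real.sqrt (lam - 1) * t))) = lam / (lam - 1)}

/-- The smallest positive solution `a = a(λ)`. -/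
def aLam (lam : ℝ) : ℝ := sInf (aSet lam)

/-- The stream function `Ψ_L^{λ,W}` of the Lamb dipole, written in polar coordinates
`x₁ = r cos θ`, `x₂ = r sin θ` (so that `sin θ = x₂ / r`). -/
def PsiL (lam W : ℝ) (x : ℝ × ℝ) : ℝ :=
  if rad x ≤ aLam lam then
    ((-(W * aLam lam / (lam - 1)) / J1 (Real.sqrt (lam - 1) * aLam lam)) *
        J1 (Real.sqrt (lam - 1) * rad x) + (W * lam / (lam - 1)) * rad x) * (x.2 / rad x)
  else (W * aLam lam / K1 (aLam lam)) * K1 (rad x) * (x.2 / rad x)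

/-- The Lamb dipole `ω_L^{λ,W} = λ (Ψ_L^{λ,W} − W x₂)₊` restricted to `Π`. -/
def omegaL (lam W : ℝ) (x : ℝ × ℝ) : ℝ :=
  if 0 < x.2 then lam * max (PsiL lam W x - W * x.2) 0 else 0

/-- `ϱ(λ) = (∫_Π ω_L^{λ,1} dx) / I(ω_L^{λ,1})`. -/
def varrho (lam : ℝ) : ℝ := (∫ x in UHP, omegaL lam 1 x) / impulse (omegaL lam 1)

/-- The Laplacian on `ℝ²`, written coordinatewise. -/
def lap (ψ : ℝ × ℝ → ℝ) (x : ℝ × ℝ) : ℝ :=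
  deriv (deriv fun t => ψ (t, x.2)) x.1 + deriv (deriv fun t => ψ (x.1, t)) x.2

/-- Distance (in `L¹ ∩ L²` plus weighted `L¹`) from `ζ` to a set of functions `S`. -/
def distToSet (S : Set ((ℝ × ℝ) → ℝ)) (ζ : (ℝ × ℝ) → ℝ) : ℝ :=
  sInf {d | ∃ ω ∈ S, d = normL1 (fun x => ζ x - ω x) + normL2 (fun x => ζ x - ω x) +
    normL1 (fun x => x.2 * (ζ x - ω x))}

end


/-! ### Kernel estimates -/

theorem exp_neg_le_rpow {s : ℝ} (hs : 0 < s) : Real.exp (-s) ≤ s ^ (-(1/4) : ℝ) := by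
  have h1 : s ^ ((1/4) : ℝ) ≤ Real.exp s := by
    rcases le_total s 1 with h | h
    · calc s ^ ((1/4) : ℝ) ≤ 1 := Real.rpow_le_one hs.le h (by norm_num)
        _ ≤ Real.exp s := Real.one_le_exp hs.le
    · calc s ^ ((1/4) : ℝ) ≤ s ^ (1 : ℝ) := Real.rpow_le_rpow_of_exponent_le h (by norm_num)
        _ = s := Real.rpow_one s
        _ ≤ Real.exp s := by linarith [Real.add_one_le_exp s]
  rw [Real.exp_neg, Real.rpow_neg hs.le]
  exact inv_anti₀ (Real.rpow_pos_of_pos hs _) h1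

theorem K0_integrand_le {r t : ℝ} (hr : 0 < r) :
    Real.exp (-(r * Real.cosh t)) ≤
      ((r / 4) ^ (-(1/4) : ℝ) * Real.exp (-r / 2)) * Real.exp (-(1/4) * t) := by
  have hc : 1 ≤ Real.cosh t := Real.one_le_cosh t
  have hc2 : Real.exp t / 2 ≤ Real.cosh t := by
    rw [Real.cosh_eq]; linarith [Real.exp_pos (-t)]
  have e1 : Real.exp (-(r * Real.cosh t)) =
      Real.exp (-(r * Real.cosh t / 2)) * Real.exp (-(r * Real.cosh t / 2)) := by
    rw [← Real.exp_add]; ring_nf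
  have e2 : Real.exp (-(r * Real.cosh t / 2)) ≤ Real.exp (-r / 2) := by
    apply Real.exp_le_exp.mpr; nlinarith
  have e3 : Real.exp (-(r * Real.cosh t / 2)) ≤
      (r / 4) ^ (-(1/4) : ℝ) * Real.exp (-(1/4) * t) := by
    calc Real.exp (-(r * Real.cosh t / 2)) ≤ Real.exp (-(r / 4 * Real.exp t)) := by
          apply Real.exp_le_exp.mpr; nlinarith
      _ ≤ (r / 4 * Real.exp t) ^ (-(1/4) : ℝ) := exp_neg_le_rpow (by positivity)
      _ = _ := by
          rw [Real.mul_rpow (by positivity) (by positivity), ← Real.exp_mul]; ring_nf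
  rw [e1]
  calc _ ≤ Real.exp (-r / 2) * ((r / 4) ^ (-(1/4) : ℝ) * Real.exp (-(1/4) * t)) :=
        mul_le_mul e2 e3 (Real.exp_pos _).le (Real.exp_pos _).le
    _ = _ := by ring

theorem K0_integrable {r : ℝ} (hr : 0 < r) :
    IntegrableOn (fun t => Real.exp (-(r * Real.cosh t))) (Set.Ioi 0) := by
  have h := (integrableOn_exp_mul_Ioi (a := -(1/4)) (by norm_num) 0).const_mul
    ((r / 4) ^ (-(1/4) : ℝ) * Real.exp (-r / 2))
  refine Integrable.mono' h (by fun_prop) (Eventually.of_forall fun t => ?_)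
  rw [Real.norm_of_nonneg (Real.exp_pos _).le]
  exact K0_integrand_le hr

theorem K0_nonneg (r : ℝ) : 0 ≤ K0 r := integral_nonneg fun _ => (Real.exp_pos _).le

theorem K0_le {r : ℝ} (hr : 0 < r) :
    K0 r ≤ 4 * ((r / 4) ^ (-(1/4) : ℝ) * Real.exp (-r / 2)) := by
  have h := (integrableOn_exp_mul_Ioi (a := -(1/4)) (by norm_num) 0).const_mul
    ((r / 4) ^ (-(1/4) : ℝ) * Real.exp (-r / 2))
  have := integral_mono (K0_integrable hr) h (fun t => K0_integrand_le hr)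
  rw [integral_const_mul, integral_exp_mul_Ioi (by norm_num)] at this
  unfold K0
  refine this.trans (le_of_eq ?_)
  simp; ring

theorem K0_anti {r s : ℝ} (hr : 0 < r) (hrs : r ≤ s) : K0 s ≤ K0 r := by
  apply integral_mono (K0_integrable (hr.trans_le hrs)) (K0_integrable hr)
  intro t
  apply Real.exp_le_exp.mpr
  have := Real.cosh_pos t
  nlinarith

theorem K0_meas : StronglyMeasurable K0 := by
  unfold K0
  apply StronglyMeasurable.integral_prod_right
    (f := fun r t => Real.exp (-(r * Real.cosh t)))
  apply Continuous.stronglyMeasurable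
  unfold Function.uncurry
  fun_prop

noncomputable def kf (z : ℝ × ℝ) : ℝ := (1 / (2 * Real.pi)) * K0 (rad z)

theorem rad_cont : Continuous rad := by unfold rad; fun_prop

theorem kf_meas : Measurable kf :=
  (K0_meas.measurable.comp rad_cont.measurable).const_mul _

theorem kf_nonneg (z : ℝ × ℝ) : 0 ≤ kf z := mul_nonneg (by positivity) (K0_nonneg _)

noncomputable def phi (s : ℝ) : ℝ := |s| ^ (-(1/4) : ℝ) * Real.exp (-(1/4) * |s|)

noncomputable def psi (s : ℝ) : ℝ := Real.exp (-(1/4) * |s|)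

theorem integrable_of_abs {f : ℝ → ℝ} (h : IntegrableOn f (Set.Ioi 0)) :
    Integrable (fun x => f |x|) := by
  have h1 : IntegrableOn (fun x => f |x|) (Set.Ioi 0) := by
    refine h.congr_fun (fun x hx => ?_) measurableSet_Ioi
    rw [abs_of_pos hx]
  have h2 : IntegrableOn (fun x => f |x|) (Set.Iic 0) := by
    rw [integrableOn_Iic_iff_integrableOn_Iio]
    have := ((Measure.measurePreserving_neg (volume : Measure ℝ)).integrableOn_comp_preimage
      (Homeomorph.neg ℝ).measurableEmbedding (f := fun x => f |x|) (s := Set.Ioi 0)).2 h1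
    simpa [Function.comp_def] using this
  have := h2.union h1
  rwa [Set.Iic_union_Ioi, integrableOn_univ] at this

theorem phi_int : Integrable phi := by
  have := integrable_of_abs (integrableOn_rpow_mul_exp_neg_mul_rpow (p := 1) (s := -(1/4))
    (b := 1/4) (by norm_num) (by norm_num) (by norm_num))
  refine this.congr (Eventually.of_forall fun s => ?_)
  simp only [phi, Real.rpow_one]

theorem phi_sq_int : Integrable (fun s => phi s ^ 2) := by
  have := integrable_of_abs (integrableOn_rpow_mul_exp_neg_mul_rpow (p := 1) (s := -(1/2))
    (b := 1/2) (by norm_num) (by norm_num) (by norm_num))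
  refine this.congr (Eventually.of_forall fun s => ?_)
  simp only [phi, mul_pow, Real.rpow_one]
  rw [← Real.rpow_natCast, ← Real.rpow_mul (abs_nonneg s), ← Real.exp_nat_mul]
  norm_num
  left; ring

theorem psi_int : Integrable psi := by
  have := integrable_of_abs (integrableOn_exp_mul_Ioi (a := -(1/4)) (by norm_num) 0)
  exact this

theorem psi_sq_int : Integrable (fun s => psi s ^ 2) := by
  have := integrable_of_abs (integrableOn_exp_mul_Ioi (a := -(1/2)) (by norm_num) 0)
  refine this.congr (Eventually.of_forall fun s => ?_)
  simp only [psi]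
  rw [← Real.exp_nat_mul]
  norm_num
  ring

theorem phi_nonneg (s : ℝ) : 0 ≤ phi s := by unfold phi; positivity
theorem psi_nonneg (s : ℝ) : 0 ≤ psi s := by unfold psi; positivity
theorem psi_le_one (s : ℝ) : psi s ≤ 1 := by
  unfold psi; apply Real.exp_le_one_iff.mpr; nlinarith [abs_nonneg s]

theorem kf_le {z : ℝ × ℝ} (hz : z.1 ≠ 0) : kf z ≤ 16 * (phi z.1 * psi z.2) := by
  have ha : 0 < |z.1| := abs_pos.mpr hz
  have h1 : |z.1| ≤ rad z := by
    unfold rad; apply Real.abs_le_sqrt; nlinarith [sq_nonneg z.2]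
  have h2 : |z.2| ≤ rad z := by
    unfold rad; apply Real.abs_le_sqrt; nlinarith [sq_nonneg z.1]
  have hr : 0 < rad z := ha.trans_le h1
  have hp : 1 / (2 * Real.pi) ≤ 1 := by
    rw [div_le_one (by positivity)]; linarith [Real.pi_gt_three]
  have h3 : (rad z / 4) ^ (-(1/4) : ℝ) ≤ 4 * |z.1| ^ (-(1/4) : ℝ) := by
    rw [Real.div_rpow hr.le (by norm_num), div_eq_inv_mul, ← Real.rpow_neg (by norm_num)]
    apply mul_le_mul _ _ (by positivity) (by norm_num)
    · calc (4:ℝ) ^ (-(-(1/4)) : ℝ) ≤ 4 ^ (1:ℝ) :=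
            Real.rpow_le_rpow_of_exponent_le (by norm_num) (by norm_num)
        _ = 4 := by norm_num
    · exact Real.rpow_le_rpow_of_nonpos ha h1 (by norm_num)
  have h4 : Real.exp (-rad z / 2) ≤ Real.exp (-(1/4) * |z.1|) * Real.exp (-(1/4) * |z.2|) := by
    rw [← Real.exp_add]; apply Real.exp_le_exp.mpr; linarith
  calc kf z ≤ 1 * K0 (rad z) := mul_le_mul_of_nonneg_right hp (K0_nonneg _)
    _ = K0 (rad z) := one_mul _
    _ ≤ _ := K0_le hr
    _ ≤ 4 * ((4 * |z.1| ^ (-(1/4) : ℝ)) *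
          (Real.exp (-(1/4) * |z.1|) * Real.exp (-(1/4) * |z.2|))) := by gcongr
    _ = _ := by unfold phi psi; ring

theorem ae_fst_ne : ∀ᵐ z : ℝ × ℝ, z.1 ≠ 0 := by
  have : ∀ᵐ s : ℝ, s ≠ 0 := by simp [ae_iff]
  exact Measure.quasiMeasurePreserving_fst.ae this

theorem kf_int : Integrable kf := by
  have h := (phi_int.mul_prod psi_int).const_mul 16
  refine Integrable.mono' h kf_meas.aestronglyMeasurable ?_
  filter_upwards [ae_fst_ne] with z hz
  rw [Real.norm_of_nonneg (kf_nonneg z)]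
  exact kf_le hz

theorem kf_sq_int : Integrable (fun z => kf z ^ 2) := by
  have h := (phi_sq_int.mul_prod psi_sq_int).const_mul (16 ^ 2)
  refine Integrable.mono' h (kf_meas.pow_const 2).aestronglyMeasurable ?_
  filter_upwards [ae_fst_ne] with z hz
  rw [Real.norm_of_nonneg (by positivity)]
  calc kf z ^ 2 ≤ (16 * (phi z.1 * psi z.2)) ^ 2 :=
        pow_le_pow_left₀ (kf_nonneg z) (kf_le hz) 2
    _ = _ := by ring

theorem strip_le {s : ℝ} (hs : 0 ≤ s) :
    ∫ z in {z : ℝ × ℝ | -s < z.2 ∧ z.2 ≤ s}, kf z ≤ (32 * ∫ t, phi t) * s := by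
  have hset : {z : ℝ × ℝ | -s < z.2 ∧ z.2 ≤ s} = Set.univ ×ˢ Set.Ioc (-s) s := by
    ext z; simp
  rw [hset]
  have hI : Integrable (fun z : ℝ × ℝ => 16 * (phi z.1 * 1))
      (volume.restrict (Set.univ ×ˢ Set.Ioc (-s) s)) := by
    rw [Measure.volume_eq_prod, ← Measure.prod_restrict, Measure.restrict_univ]
    exact (phi_int.mul_prod (integrable_const 1)).const_mul 16
  have h1 : ∫ z in Set.univ ×ˢ Set.Ioc (-s) s, kf z ≤
      ∫ z in Set.univ ×ˢ Set.Ioc (-s) s, 16 * (phi z.1 * 1) := by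
    apply integral_mono_ae kf_int.integrableOn hI
    filter_upwards [ae_restrict_of_ae ae_fst_ne] with z hz
    refine (kf_le hz).trans ?_
    have := psi_le_one z.2
    have := phi_nonneg z.1
    gcongr
  refine h1.trans (le_of_eq ?_)
  rw [integral_const_mul, Measure.volume_eq_prod, setIntegral_prod_mul phi (fun _ => 1)]
  simp [hs]
  ring

/-! ### The Green operator on the half plane -/

theorem measurableSet_UHP : MeasurableSet UHP := measurableSet_lt measurable_const measurable_snd

theorem GUHP_eq (x y : ℝ × ℝ) : GUHP x y = kf (x - y) - kf (x - reflPt y) := by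
  unfold GUHP Gker kf reflPt rad
  simp only [Prod.fst_sub, Prod.snd_sub]
  congr 5
  ring

theorem GUHP_symm (x y : ℝ × ℝ) : GUHP x y = GUHP y x := by
  simp only [GUHP_eq, kf, reflPt, rad, Prod.fst_sub, Prod.snd_sub]
  congr 5 <;> ring

theorem GUHP_meas : Measurable (fun p : (ℝ × ℝ) × (ℝ × ℝ) => GUHP p.1 p.2) := by
  simp only [GUHP_eq]
  apply Measurable.sub
  · exact kf_meas.comp (measurable_fst.sub measurable_snd)
  · apply kf_meas.comp
    unfold reflPt
    fun_prop

theorem GUHP_bounds {x y : ℝ × ℝ} (hx : x ∈ UHP) (hy : y ∈ UHP) (hxy : x ≠ y) :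
    0 ≤ GUHP x y ∧ GUHP x y ≤ kf (x - y) := by
  have hx' : 0 < x.2 := hx
  have hy' : 0 < y.2 := hy
  rw [GUHP_eq]
  have h0 : 0 < rad (x - y) := by
    unfold rad
    apply Real.sqrt_pos.mpr
    by_contra h
    push Not at h
    apply hxy
    simp only [Prod.fst_sub, Prod.snd_sub] at h
    have h1 : x.1 - y.1 = 0 := by nlinarith [sq_nonneg (x.1 - y.1), sq_nonneg (x.2 - y.2)]
    have h2 : x.2 - y.2 = 0 := by nlinarith [sq_nonneg (x.1 - y.1), sq_nonneg (x.2 - y.2)]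
    exact Prod.ext (by linarith) (by linarith)
  have h1 : rad (x - y) ≤ rad (x - reflPt y) := by
    unfold rad reflPt
    apply Real.sqrt_le_sqrt
    simp only [Prod.fst_sub, Prod.snd_sub]
    nlinarith [mul_pos hx' hy']
  have h2 : kf (x - reflPt y) ≤ kf (x - y) :=
    mul_le_mul_of_nonneg_left (K0_anti h0 h1) (by positivity)
  exact ⟨by linarith, by linarith [kf_nonneg (x - reflPt y)]⟩

theorem ae_GUHP {x : ℝ × ℝ} (hx : x ∈ UHP) :
    ∀ᵐ y ∂(volume.restrict UHP), 0 ≤ GUHP x y ∧ GUHP x y ≤ kf (x - y) := by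
  have h1 : ∀ᵐ y : ℝ × ℝ, y ≠ x := by simp [ae_iff]
  filter_upwards [ae_restrict_of_ae h1, ae_restrict_mem measurableSet_UHP] with y h hy
  exact GUHP_bounds hx hy h.symm

theorem ae_prod_GUHP :
    ∀ᵐ p ∂((volume.restrict UHP).prod (volume.restrict UHP)),
      0 ≤ GUHP p.1 p.2 ∧ GUHP p.1 p.2 ≤ kf (p.1 - p.2) := by
  have hm : MeasurableSet {p : (ℝ × ℝ) × (ℝ × ℝ) |
      0 ≤ GUHP p.1 p.2 ∧ GUHP p.1 p.2 ≤ kf (p.1 - p.2)} :=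
    (measurableSet_le measurable_const GUHP_meas).inter
      (measurableSet_le GUHP_meas (kf_meas.comp (measurable_fst.sub measurable_snd)))
  rw [Measure.ae_prod_iff_ae_ae hm]
  filter_upwards [ae_restrict_mem measurableSet_UHP] with x hx
  exact ae_GUHP hx

/-- Class `L¹ ∩ L²` on the half plane. -/
def XX (f : ℝ × ℝ → ℝ) : Prop :=
  Integrable f (volume.restrict UHP) ∧ Integrable (fun x => f x ^ 2) (volume.restrict UHP)

noncomputable def MM : ℝ := ∫ z, kf z ^ 2

theorem MM_nonneg : 0 ≤ MM := integral_nonneg fun z => by positivity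

theorem Gop_int {f : ℝ × ℝ → ℝ} (hf : XX f) {x : ℝ × ℝ} (hx : x ∈ UHP) {c : ℝ} (hc : 0 < c) :
    Integrable (fun y => GUHP x y * f y) (volume.restrict UHP) ∧
    |Gop f x| ≤ (c * MM + (∫ y in UHP, f y ^ 2) / c) / 2 := by
  have hk : Integrable (fun y => kf (x - y) ^ 2) := kf_sq_int.comp_sub_left x
  have hd : Integrable (fun y => (c * kf (x - y) ^ 2 + f y ^ 2 / c) / 2)
      (volume.restrict UHP) :=
    ((hk.integrableOn.const_mul c).add (hf.2.div_const c)).div_const 2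
  have hb : ∀ᵐ y ∂(volume.restrict UHP),
      ‖GUHP x y * f y‖ ≤ (c * kf (x - y) ^ 2 + f y ^ 2 / c) / 2 := by
    filter_upwards [ae_GUHP hx] with y hy
    rw [norm_mul, Real.norm_of_nonneg hy.1, Real.norm_eq_abs]
    have h1 : GUHP x y * |f y| ≤ kf (x - y) * |f y| :=
      mul_le_mul_of_nonneg_right hy.2 (abs_nonneg _)
    have h2 : 2 * (kf (x - y) * |f y|) ≤ c * kf (x - y) ^ 2 + f y ^ 2 / c := by
      have e : c * kf (x - y) ^ 2 + f y ^ 2 / c - 2 * (kf (x - y) * |f y|)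
          = (c * kf (x - y) - |f y|) ^ 2 / c := by
        rw [← sq_abs (f y)]; field_simp; ring
      have : 0 ≤ (c * kf (x - y) - |f y|) ^ 2 / c := by positivity
      linarith
    linarith
  have hm : AEStronglyMeasurable (fun y => GUHP x y * f y) (volume.restrict UHP) :=
    (GUHP_meas.comp measurable_prodMk_left).aestronglyMeasurable.mul hf.1.aestronglyMeasurable
  refine ⟨Integrable.mono' hd hm hb, ?_⟩
  have h1 := norm_integral_le_of_norm_le hd hb
  rw [Real.norm_eq_abs] at h1
  refine h1.trans ?_
  rw [integral_div, integral_add (hk.integrableOn.const_mul c) (hf.2.div_const c),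
    integral_const_mul, integral_div]
  have h2 : ∫ y in UHP, kf (x - y) ^ 2 ≤ MM := by
    calc ∫ y in UHP, kf (x - y) ^ 2 ≤ ∫ y, kf (x - y) ^ 2 :=
          setIntegral_le_integral hk (Eventually.of_forall fun y => by positivity)
      _ = MM := integral_sub_left_eq_self (fun z => kf z ^ 2) volume x
  gcongr

theorem Gop_meas {f : ℝ × ℝ → ℝ} (hf : XX f) :
    AEStronglyMeasurable (Gop f) (volume.restrict UHP) := by
  unfold Gop
  exact AEStronglyMeasurable.integral_prod_right' (f := fun p => GUHP p.1 p.2 * f p.2)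
    (GUHP_meas.aestronglyMeasurable.mul hf.1.aestronglyMeasurable.comp_snd)

theorem pair_int {f g : ℝ × ℝ → ℝ} (hf : XX f) (hg : XX g) :
    Integrable (fun x => f x * Gop g x) (volume.restrict UHP) := by
  refine Integrable.mono' (hf.1.norm.const_mul ((1 * MM + (∫ y in UHP, g y ^ 2) / 1) / 2))
    (hf.1.aestronglyMeasurable.mul (Gop_meas hg)) ?_
  filter_upwards [ae_restrict_mem measurableSet_UHP] with x hx
  rw [norm_mul, mul_comm]
  exact mul_le_mul_of_nonneg_right (Gop_int hg hx one_pos).2 (norm_nonneg _)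

/-- Joint integrability of convolution-type integrands restricted to the half plane. -/
theorem conv_int {f : ℝ × ℝ → ℝ} {k : ℝ × ℝ → ℝ} (hf : Integrable f (volume.restrict UHP))
    (hk : Integrable k) :
    Integrable (fun p : (ℝ × ℝ) × (ℝ × ℝ) => f p.2 * k (p.1 - p.2))
      ((volume.restrict UHP).prod (volume.restrict UHP)) := by
  have := Integrable.convolution_integrand (ContinuousLinearMap.mul ℝ ℝ) (μ := volume) hf hk
  refine this.mono_measure ?_
  exact Measure.prod_mono Measure.restrict_le_self le_rfl

theorem triple_int {f g : ℝ × ℝ → ℝ} (hf : XX f) (hg : XX g) :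
    Integrable (fun p : (ℝ × ℝ) × (ℝ × ℝ) => f p.1 * (GUHP p.1 p.2 * g p.2))
      ((volume.restrict UHP).prod (volume.restrict UHP)) := by
  have h1 := (conv_int hg.1.norm kf_sq_int).div_const 2
  have h2 := (hf.2.mul_prod hg.1.norm).div_const 2
  refine Integrable.mono' (h1.add h2)
    (hf.1.aestronglyMeasurable.comp_fst.mul
      (GUHP_meas.aestronglyMeasurable.mul hg.1.aestronglyMeasurable.comp_snd)) ?_
  filter_upwards [ae_prod_GUHP] with p hp
  simp only [Pi.add_apply, norm_mul, Real.norm_eq_abs, abs_of_nonneg hp.1]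
  have h3 : |f p.1| * GUHP p.1 p.2 ≤ (kf (p.1 - p.2) ^ 2 + f p.1 ^ 2) / 2 := by
    have := mul_le_mul_of_nonneg_left hp.2 (abs_nonneg (f p.1))
    nlinarith [sq_nonneg (|f p.1| - kf (p.1 - p.2)), sq_abs (f p.1)]
  nlinarith [mul_le_mul_of_nonneg_right h3 (abs_nonneg (g p.2))]

theorem pair_symm {f g : ℝ × ℝ → ℝ} (hf : XX f) (hg : XX g) :
    ∫ x in UHP, f x * Gop g x = ∫ x in UHP, g x * Gop f x := by
  unfold Gop
  simp_rw [← integral_const_mul]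
  rw [integral_integral_swap (triple_int hf hg)]
  congr 1; ext y; congr 1; ext x
  rw [GUHP_symm x y]; ring

theorem Gop_nonneg {f : ℝ × ℝ → ℝ} (hf : ∀ x ∈ UHP, 0 ≤ f x) {x : ℝ × ℝ} (hx : x ∈ UHP) :
    0 ≤ Gop f x := by
  apply integral_nonneg_of_ae
  filter_upwards [ae_GUHP hx, ae_restrict_mem measurableSet_UHP] with y hy hyU
  exact mul_nonneg hy.1 (hf y hyU)

theorem GUHP_col {y : ℝ × ℝ} (hy : y ∈ UHP) :
    ∫ x in UHP, GUHP x y ≤ (32 * ∫ t, phi t) * y.2 := by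
  have hy' : 0 < y.2 := hy
  simp_rw [GUHP_eq]
  have ha : ∀ w : ℝ × ℝ, ∫ x in UHP, kf (x - w) = ∫ z in {z : ℝ × ℝ | -w.2 < z.2}, kf z := by
    intro w
    have hm : MeasurableSet {z : ℝ × ℝ | -w.2 < z.2} :=
      measurableSet_lt measurable_const measurable_snd
    rw [← integral_indicator measurableSet_UHP, ← integral_indicator hm,
      
      ← integral_sub_right_eq_self ({z : ℝ × ℝ | -w.2 < z.2}.indicator kf) w]
    congr 1; ext x
    by_cases h : 0 < x.2
    · rw [Set.indicator_of_mem (show x ∈ UHP from h),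
        Set.indicator_of_mem (show x - w ∈ {z : ℝ × ℝ | -w.2 < z.2} by
          change -w.2 < x.2 - w.2; linarith)]
    · rw [Set.indicator_of_notMem (show x ∉ UHP from h),
        Set.indicator_of_notMem (show x - w ∉ {z : ℝ × ℝ | -w.2 < z.2} by
          change ¬ (-w.2 < x.2 - w.2); intro h2; apply h; linarith)]
  rw [integral_sub (kf_int.comp_sub_right y).integrableOn
    (kf_int.comp_sub_right (reflPt y)).integrableOn, ha, ha]
  refine le_trans (le_of_eq ?_) (strip_le hy'.le)
  have hm : MeasurableSet {z : ℝ × ℝ | y.2 < z.2} :=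
    measurableSet_lt measurable_const measurable_snd
  have hsub : {z : ℝ × ℝ | y.2 < z.2} ⊆ {z : ℝ × ℝ | -y.2 < z.2} := by
    intro z hz
    simp only [Set.mem_ofPred_eq] at *
    linarith
  have h := setIntegral_sdiff hm kf_int.integrableOn hsub (f := kf)
  simp only [reflPt, neg_neg]
  rw [← h]
  congr 2
  ext z; simp

theorem Gop_mass {f : ℝ × ℝ → ℝ} (hf : ∀ x ∈ UHP, 0 ≤ f x)
    (hi : Integrable f (volume.restrict UHP))
    (hi2 : Integrable (fun x => x.2 * f x) (volume.restrict UHP)) :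
    Integrable (Gop f) (volume.restrict UHP) ∧
    ∫ x in UHP, Gop f x ≤ (32 * ∫ t, phi t) * impulse f := by
  have hI : Integrable (fun p : (ℝ × ℝ) × (ℝ × ℝ) => GUHP p.1 p.2 * f p.2)
      ((volume.restrict UHP).prod (volume.restrict UHP)) := by
    refine Integrable.mono' (conv_int hi.norm kf_int)
      (GUHP_meas.aestronglyMeasurable.mul hi.aestronglyMeasurable.comp_snd) ?_
    filter_upwards [ae_prod_GUHP] with p hp
    rw [norm_mul, Real.norm_of_nonneg hp.1, mul_comm]
    exact mul_le_mul_of_nonneg_left hp.2 (norm_nonneg _)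
  refine ⟨hI.integral_prod_left, ?_⟩
  unfold Gop impulse
  rw [integral_integral_swap hI, ← integral_const_mul]
  apply integral_mono_ae hI.integral_prod_right (hi2.const_mul _)
  filter_upwards [ae_restrict_mem measurableSet_UHP] with y hy
  rw [integral_mul_const]
  calc _ ≤ ((32 * ∫ t, phi t) * y.2) * f y :=
        mul_le_mul_of_nonneg_right (GUHP_col hy) (hf y hy)
    _ = _ := by ring

/-! ### The variational argument -/

theorem iadd {f g : ℝ × ℝ → ℝ} (hf : Integrable f (volume.restrict UHP))
    (hg : Integrable g (volume.restrict UHP)) :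
    Integrable (fun x => f x + g x) (volume.restrict UHP) := hf.add hg

theorem isub {f g : ℝ × ℝ → ℝ} (hf : Integrable f (volume.restrict UHP))
    (hg : Integrable g (volume.restrict UHP)) :
    Integrable (fun x => f x - g x) (volume.restrict UHP) := hf.sub hg

theorem XX.add_smul {f g : ℝ × ℝ → ℝ} (hf : XX f) (hg : XX g) (e : ℝ) :
    XX (fun x => f x + e * g x) := by
  refine ⟨hf.1.add (hg.1.const_mul e), ?_⟩
  refine Integrable.mono' ((hf.2.const_mul 2).add (hg.2.const_mul (2 * e ^ 2)))
    ((hf.1.aestronglyMeasurable.add (hg.1.aestronglyMeasurable.const_mul e)).pow 2)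
    (Eventually.of_forall fun x => ?_)
  rw [Real.norm_of_nonneg (by positivity)]
  simp only [Pi.add_apply]
  nlinarith [sq_nonneg (f x - e * g x)]

theorem XX.mul_int {f g : ℝ × ℝ → ℝ} (hf : XX f) (hg : XX g) :
    Integrable (fun x => f x * g x) (volume.restrict UHP) := by
  refine Integrable.mono' (hf.2.add hg.2)
    (hf.1.aestronglyMeasurable.mul hg.1.aestronglyMeasurable) (Eventually.of_forall fun x => ?_)
  simp only [Pi.add_apply, Real.norm_eq_abs]
  rw [abs_le]
  constructor <;> nlinarith [sq_nonneg (f x - g x), sq_nonneg (f x + g x)]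

theorem Gop_add {f g : ℝ × ℝ → ℝ} (hf : XX f) (hg : XX g) (e : ℝ) {x : ℝ × ℝ} (hx : x ∈ UHP) :
    Gop (fun x => f x + e * g x) x = Gop f x + e * Gop g x := by
  unfold Gop
  rw [← integral_const_mul, ← integral_add (Gop_int hf hx one_pos).1
    ((Gop_int hg hx one_pos).1.const_mul e)]
  congr 1; ext y; ring

theorem Efun_expand {f g : ℝ × ℝ → ℝ} (hf : XX f) (hg : XX g) (lam e : ℝ) :
    Efun lam (fun x => f x + e * g x) = Efun lam f
      + e * ((∫ x in UHP, g x * Gop f x) - (1 / lam) * ∫ x in UHP, f x * g x)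
      + e ^ 2 * Efun lam g := by
  have h1 : ∫ x in UHP, (f x + e * g x) * Gop (fun x => f x + e * g x) x =
      (∫ x in UHP, f x * Gop f x) + 2 * e * (∫ x in UHP, g x * Gop f x)
        + e ^ 2 * ∫ x in UHP, g x * Gop g x := by
    have : ∫ x in UHP, (f x + e * g x) * Gop (fun x => f x + e * g x) x =
        ∫ x in UHP, ((f x * Gop f x + e * (f x * Gop g x)) + (e * (g x * Gop f x)
          + e ^ 2 * (g x * Gop g x))) := by
      apply setIntegral_congr_fun measurableSet_UHP
      intro x hx
      simp only [Gop_add hf hg e hx]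
      ring
    rw [this, integral_add (iadd (pair_int hf hf) ((pair_int hf hg).const_mul e))
      (iadd ((pair_int hg hf).const_mul e) ((pair_int hg hg).const_mul (e ^ 2))),
      integral_add (pair_int hf hf) ((pair_int hf hg).const_mul e),
      integral_add ((pair_int hg hf).const_mul e) ((pair_int hg hg).const_mul (e ^ 2)),
      integral_const_mul, integral_const_mul, integral_const_mul, pair_symm hf hg]
    ring
  have h2 : ∫ x in UHP, (f x + e * g x) ^ 2 =
      (∫ x in UHP, f x ^ 2) + 2 * e * (∫ x in UHP, f x * g x) + e ^ 2 * ∫ x in UHP, g x ^ 2 := by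
    have : ∀ x, (f x + e * g x) ^ 2 = (f x ^ 2 + 2 * e * (f x * g x)) + e ^ 2 * g x ^ 2 := by
      intro x; ring
    simp_rw [this]
    rw [integral_add (iadd hf.2 ((hf.mul_int hg).const_mul (2 * e))) (hg.2.const_mul _),
      integral_add hf.2 ((hf.mul_int hg).const_mul (2 * e)), integral_const_mul,
      integral_const_mul]
  unfold Efun kineticE
  rw [h1, h2]
  ring

theorem Efun_bdd (lam μ ν : ℝ) (hlam : 1 < lam) (hν : 0 < ν) :
    BddAbove {s | ∃ ω, InAdm μ ν ω ∧ s = Efun lam ω} := by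
  refine ⟨ν * (lam * ν / 2 * MM) / 4, ?_⟩
  rintro s ⟨ω, ⟨h0, h1, h2, h3, h4, h5⟩, rfl⟩
  have hX : XX ω := ⟨h1, h2⟩
  set Q := ∫ x in UHP, ω x ^ 2 with hQ
  have hQ0 : 0 ≤ Q := integral_nonneg fun x => by positivity
  have hc : 0 < lam * ν / 2 := by positivity
  set B := (lam * ν / 2 * MM + Q / (lam * ν / 2)) / 2 with hB
  have hB0 : 0 ≤ B := by have := MM_nonneg; positivity
  have hE : ∫ x in UHP, ω x * Gop ω x ≤ B * ν := by
    calc ∫ x in UHP, ω x * Gop ω x ≤ ∫ x in UHP, B * ω x := by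
          apply integral_mono_ae (pair_int hX hX) (h1.const_mul B)
          filter_upwards [ae_restrict_mem measurableSet_UHP] with x hx
          rw [mul_comm]
          exact mul_le_mul_of_nonneg_right
            ((le_abs_self _).trans (Gop_int hX hx hc).2) (h0 x hx)
      _ = B * ∫ x in UHP, ω x := integral_const_mul _ _
      _ ≤ B * ν := mul_le_mul_of_nonneg_left h5 hB0
  unfold Efun kineticE
  have e : B * ν = lam * ν / 2 * MM * ν / 2 + Q / lam := by
    rw [hB]; field_simp
  have e2 : 1 / (2 * lam) * Q = Q / lam / 2 := by field_simp
  rw [← hQ, e2]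
  rw [e] at hE
  linarith

set_option maxHeartbeats 1000000 in
theorem maximizer_le {lam μ ν : ℝ} (hlam : 1 < lam) (hν : 0 < ν)
    {ω : ℝ × ℝ → ℝ} (hω : IsMaximizer lam μ ν ω) :
    ∀ᵐ x ∂(volume.restrict UHP), ω x ≤ lam * Gop ω x := by
  obtain ⟨⟨h0, h1, h2, h3, h4, h5⟩, hmax⟩ := hω
  have hX : XX ω := ⟨h1, h2⟩
  have hl : 0 < lam := by linarith
  set h : ℝ × ℝ → ℝ := fun x => max (ω x - lam * Gop ω x) 0 with hh
  have hnn : ∀ x, 0 ≤ h x := fun x => le_max_right _ _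
  have hle : ∀ x ∈ UHP, h x ≤ ω x := by
    intro x hx
    apply max_le _ (h0 x hx)
    have := Gop_nonneg h0 hx
    nlinarith
  have hmeas : AEStronglyMeasurable h (volume.restrict UHP) :=
    (h1.aestronglyMeasurable.sub ((Gop_meas hX).const_mul lam)).sup aestronglyMeasurable_const
  have hXh : XX h := by
    refine ⟨Integrable.mono' h1 hmeas ?_, Integrable.mono' h2 (hmeas.pow 2) ?_⟩
    · filter_upwards [ae_restrict_mem measurableSet_UHP] with x hx
      rw [Real.norm_of_nonneg (hnn x)]; exact hle x hx
    · filter_upwards [ae_restrict_mem measurableSet_UHP] with x hx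
      rw [Real.norm_of_nonneg (by positivity)]
      exact pow_le_pow_left₀ (hnn x) (hle x hx) 2
  have hxh : Integrable (fun x => x.2 * h x) (volume.restrict UHP) := by
    refine Integrable.mono' h3 (measurable_snd.aestronglyMeasurable.mul hmeas) ?_
    filter_upwards [ae_restrict_mem measurableSet_UHP] with x hx
    have hx' : 0 < x.2 := hx
    rw [Real.norm_of_nonneg (mul_nonneg hx'.le (hnn x))]
    exact mul_le_mul_of_nonneg_left (hle x hx) hx'.le
  by_cases hT : (∫ x in UHP, h x) = 0
  · rw [integral_eq_zero_iff_of_nonneg hnn hXh.1] at hT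
    filter_upwards [hT] with x hx
    have : ω x - lam * Gop ω x ≤ h x := le_max_left _ _
    simp only [Pi.zero_apply] at hx
    linarith
  exfalso
  set H := ∫ x in UHP, h x with hHdef
  have hH : 0 < H := lt_of_le_of_ne (integral_nonneg hnn) (Ne.symm hT)
  set T := ∫ x in UHP, h x ^ 2 with hTdef
  have hTpos : 0 < T := by
    refine lt_of_le_of_ne (integral_nonneg fun x => by positivity) (fun hc => hT ?_)
    have hc' := hc.symm
    rw [hTdef, integral_eq_zero_iff_of_nonneg (fun x => by positivity) hXh.2] at hc'
    rw [hHdef, integral_eq_zero_iff_of_nonneg hnn hXh.1]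
    filter_upwards [hc'] with x hx
    simpa using hx
  set p := ∫ x in UHP, x.2 * h x with hpdef
  have hp : 0 ≤ p := by
    apply setIntegral_nonneg measurableSet_UHP
    intro x hx
    exact mul_nonneg (le_of_lt hx) (hnn x)
  set m := ∫ x in UHP, ω x with hmdef
  have hm : 0 ≤ m := setIntegral_nonneg measurableSet_UHP h0
  -- choice of the height
  obtain ⟨R, hR, hR1, hR2⟩ : ∃ R : ℝ, 0 < R ∧ p / R ≤ H ∧ p / R * m ≤ T / 2 := by
    refine ⟨p / H + 2 * p * m / T + 1, by positivity, ?_, ?_⟩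
    · rw [div_le_iff₀ (by positivity)]
      have e : H * (p / H + 2 * p * m / T + 1) = p + H * (2 * p * m / T + 1) := by
        field_simp; ring
      rw [e]
      have : 0 ≤ H * (2 * p * m / T + 1) := by positivity
      linarith
    · rw [div_mul_eq_mul_div, div_le_iff₀ (by positivity)]
      have e : T / 2 * (p / H + 2 * p * m / T + 1) = p * m + T / 2 * (p / H + 1) := by
        field_simp; ring
      rw [e]
      have : 0 ≤ T / 2 * (p / H + 1) := by positivity
      linarith
  set B : Set (ℝ × ℝ) := Set.Ioc 0 1 ×ˢ Set.Ioc R (R + 1) with hBdef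
  have hBm : MeasurableSet B := measurableSet_Ioc.prod measurableSet_Ioc
  have hBU : B ⊆ UHP := fun x hx => hR.trans hx.2.1
  have hvol : volume B = 1 := by
    rw [hBdef, Measure.volume_eq_prod, Measure.prod_prod]; simp
  have hB1 : Integrable (B.indicator (fun _ => (1 : ℝ))) (volume.restrict UHP) :=
    ((integrable_indicator_iff hBm).2 (by simp [hvol])).integrableOn
  have hBx : Integrable (fun x : ℝ × ℝ => x.2 * B.indicator (fun _ => (1 : ℝ)) x)
      (volume.restrict UHP) := by
    refine Integrable.mono' (hB1.const_mul (R + 1))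
      (measurable_snd.aestronglyMeasurable.mul hB1.aestronglyMeasurable)
      (Eventually.of_forall fun x => ?_)
    by_cases hx : x ∈ B
    · have h6 := hx.2.1
      have h7 := hx.2.2
      simp only [Set.indicator_of_mem hx, mul_one]
      rw [Real.norm_of_nonneg (by linarith)]
      exact h7
    · simp [Set.indicator_of_notMem hx]
  have hBmass : ∫ x in UHP, B.indicator (fun _ => (1 : ℝ)) x = 1 := by
    rw [setIntegral_indicator hBm, Set.inter_eq_self_of_subset_right hBU]
    simp [Measure.real, hvol]
  set J := ∫ x in UHP, x.2 * B.indicator (fun _ => (1 : ℝ)) x with hJdef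
  have hJ : R ≤ J := by
    calc R = ∫ x in UHP, R * B.indicator (fun _ => (1 : ℝ)) x := by
          rw [integral_const_mul, hBmass, mul_one]
      _ ≤ J := by
          apply integral_mono (hB1.const_mul R) hBx
          intro x
          by_cases hx : x ∈ B
          · have h6 := hx.2.1
            simp only [Set.indicator_of_mem hx, mul_one]
            exact h6.le
          · simp [Set.indicator_of_notMem hx]
  set c := p / J with hcdef
  have hJ0 : 0 < J := hR.trans_le hJ
  have hc0 : 0 ≤ c := by positivity
  have hcR : c ≤ p / R := by rw [hcdef]; gcongr
  set g : ℝ × ℝ → ℝ := fun x => c * B.indicator (fun _ => (1 : ℝ)) x with hg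
  have hgnn : ∀ x, 0 ≤ g x := fun x =>
    mul_nonneg hc0 (Set.indicator_nonneg (fun _ _ => zero_le_one) _)
  have hgc : ∀ x, g x ≤ c := by
    intro x
    by_cases hx : x ∈ B
    · simp [hg, Set.indicator_of_mem hx]
    · simp [hg, Set.indicator_of_notMem hx, hc0]
  have hXg : XX g := by
    refine ⟨hB1.const_mul c, ?_⟩
    refine (hB1.const_mul (c ^ 2)).congr (Eventually.of_forall fun x => ?_)
    by_cases hx : x ∈ B
    · simp [hg, Set.indicator_of_mem hx]
    · simp [hg, Set.indicator_of_notMem hx]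
  have hxg : Integrable (fun x => x.2 * g x) (volume.restrict UHP) := by
    refine (hBx.const_mul c).congr (Eventually.of_forall fun x => ?_)
    simp only [hg]; ring
  have hgmass : ∫ x in UHP, g x = c := by
    rw [hg, integral_const_mul, hBmass, mul_one]
  have hgimp : ∫ x in UHP, x.2 * g x = p := by
    have : ∀ x : ℝ × ℝ, x.2 * g x = c * (x.2 * B.indicator (fun _ => (1 : ℝ)) x) := by
      intro x; simp only [hg]; ring
    simp_rw [this]
    rw [integral_const_mul, ← hJdef, hcdef]
    field_simp
  -- the perturbation
  set η : ℝ × ℝ → ℝ := fun x => g x + (-1) * h x with hη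
  have hXη : XX η := hXg.add_smul hXh (-1)
  have hD1 : T / (2 * lam) ≤
      (∫ x in UHP, η x * Gop ω x) - (1 / lam) * ∫ x in UHP, ω x * η x := by
    have e1 : ∫ x in UHP, η x * Gop ω x
        = (∫ x in UHP, g x * Gop ω x) - ∫ x in UHP, h x * Gop ω x := by
      rw [← integral_sub (pair_int hXg hX) (pair_int hXh hX)]
      congr 1; ext x; simp only [hη]; ring
    have e2 : ∫ x in UHP, ω x * η x
        = (∫ x in UHP, ω x * g x) - ∫ x in UHP, ω x * h x := by
      rw [← integral_sub (hX.mul_int hXg) (hX.mul_int hXh)]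
      congr 1; ext x; simp only [hη]; ring
    have e3 : 0 ≤ ∫ x in UHP, g x * Gop ω x := by
      apply setIntegral_nonneg measurableSet_UHP
      intro x hx
      exact mul_nonneg (hgnn x) (Gop_nonneg h0 hx)
    have e4 : ∫ x in UHP, ω x * g x ≤ c * m := by
      rw [hmdef, ← integral_const_mul]
      apply setIntegral_mono_on (hX.mul_int hXg) (h1.const_mul c) measurableSet_UHP
      intro x hx
      rw [mul_comm c]
      exact mul_le_mul_of_nonneg_left (hgc x) (h0 x hx)
    have e5 : (∫ x in UHP, ω x * h x) - lam * ∫ x in UHP, h x * Gop ω x = T := by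
      rw [← integral_const_mul, ← integral_sub (hX.mul_int hXh) ((pair_int hXh hX).const_mul lam)]
      congr 1; ext x
      rcases le_total (ω x - lam * Gop ω x) 0 with h6 | h6
      · simp [hh, max_eq_right h6]
      · simp only [hh, max_eq_left h6]; ring
    have e6 : c * m ≤ T / 2 := (mul_le_mul_of_nonneg_right hcR hm).trans hR2
    rw [e1, e2]
    have e7 : (∫ x in UHP, ω x * h x) = T + lam * ∫ x in UHP, h x * Gop ω x := by linarith
    rw [e7]
    have e8 : (1 / lam) * ∫ x in UHP, ω x * g x ≤ (1 / lam) * (T / 2) :=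
      mul_le_mul_of_nonneg_left (e4.trans e6) (by positivity)
    have e9 : (1 / lam) * (T + lam * ∫ x in UHP, h x * Gop ω x)
        = 2 * (T / (2 * lam)) + ∫ x in UHP, h x * Gop ω x := by field_simp
    have e10 : (1 / lam) * (T / 2) = T / (2 * lam) := by field_simp
    rw [mul_sub, e9]
    linarith
  set D1 := (∫ x in UHP, η x * Gop ω x) - (1 / lam) * ∫ x in UHP, ω x * η x with hD1def
  have hD1pos : 0 < D1 := lt_of_lt_of_le (by positivity) hD1
  obtain ⟨e, he0, he1, he2⟩ : ∃ e : ℝ, 0 < e ∧ e ≤ 1 ∧ e * (|Efun lam η| + 1) ≤ D1 := by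
    refine ⟨min 1 (D1 / (|Efun lam η| + 1)), lt_min one_pos (by positivity), min_le_left _ _, ?_⟩
    rw [← le_div_iff₀ (by positivity)]
    exact min_le_right _ _
  have hX' : XX (fun x => ω x + e * η x) := hX.add_smul hXη e
  have hxη : Integrable (fun x => x.2 * η x) (volume.restrict UHP) := by
    refine (hxg.sub hxh).congr (Eventually.of_forall fun x => ?_)
    simp only [hη, Pi.sub_apply]; ring
  have hadm : InAdm μ ν (fun x => ω x + e * η x) := by
    refine ⟨?_, hX'.1, hX'.2, ?_, ?_, ?_⟩
    · intro x hx
      simp only [hη]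
      nlinarith [hle x hx, hnn x, hgnn x, mul_nonneg he0.le (hgnn x),
        mul_le_mul_of_nonneg_right he1 (hnn x)]
    · refine (h3.add (hxη.const_mul e)).congr (Eventually.of_forall fun x => ?_)
      simp only [Pi.add_apply]; ring
    · rw [← h4]
      unfold impulse
      have : ∀ x : ℝ × ℝ, x.2 * (ω x + e * η x) = x.2 * ω x + e * (x.2 * g x - x.2 * h x) := by
        intro x; simp only [hη]; ring
      simp_rw [this]
      rw [integral_add h3 ((isub hxg hxh).const_mul e), integral_const_mul,
        integral_sub hxg hxh, hgimp]
      ring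
    · have : ∀ x : ℝ × ℝ, ω x + e * η x = ω x + e * (g x - h x) := by
        intro x; simp only [hη]; ring
      simp_rw [this]
      rw [integral_add h1 ((isub hXg.1 hXh.1).const_mul e), integral_const_mul,
        integral_sub hXg.1 hXh.1, hgmass]
      have : c - H ≤ 0 := by linarith
      nlinarith
  have hfin : Efun lam (fun x => ω x + e * η x) ≤ Efun lam ω := by
    rw [hmax]
    exact le_csSup (Efun_bdd lam μ ν hlam hν) ⟨_, hadm, rfl⟩
  rw [Efun_expand hX hXη lam e, ← hD1def] at hfin
  have k1 : e * (D1 + e * Efun lam η) ≤ 0 := by nlinarith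
  have k2 : 0 < D1 + e * Efun lam η := by
    have := neg_abs_le (Efun lam η)
    nlinarith
  nlinarith [mul_pos he0 k2]

/-- for `ν` large, maximizers satisfy the strict mass inequality. -/
theorem stmt10 (lam μ : ℝ) (hlam : 1 < lam) (hμ : 0 < μ) :
    ∃ ν₀ : ℝ, μ * varrho lam < ν₀ ∧ ∀ ν : ℝ, ν₀ ≤ ν →
      ∀ ω : ℝ × ℝ → ℝ, IsMaximizer lam μ ν ω → (∫ x in UHP, ω x) < ν := by
  have hC : 0 ≤ lam * ((32 * ∫ t, phi t) * μ) := by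
    have : 0 ≤ ∫ t, phi t := integral_nonneg phi_nonneg
    have : 0 < lam := by linarith
    positivity
  refine ⟨max (μ * varrho lam) (lam * ((32 * ∫ t, phi t) * μ)) + 1, ?_, ?_⟩
  · linarith [le_max_left (μ * varrho lam) (lam * ((32 * ∫ t, phi t) * μ))]
  intro ν hν ω hω
  have h1 := le_max_right (μ * varrho lam) (lam * ((32 * ∫ t, phi t) * μ))
  have h2 := maximizer_le hlam (by linarith) hω
  obtain ⟨⟨h0, hi, _, h3, h4, _⟩, _⟩ := hω
  obtain ⟨h5, h6⟩ := Gop_mass h0 hi h3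
  have h7 : ∫ x in UHP, ω x ≤ lam * ∫ x in UHP, Gop ω x := by
    rw [← integral_const_mul]
    exact integral_mono_ae hi (h5.const_mul lam) h2
  rw [h4] at h6
  have h8 := mul_le_mul_of_nonneg_left h6 (show 0 ≤ lam by linarith)
  linarith
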